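/- arXiv:math/0606289 — 6 statements merged into one kernel-verified Lean document; each statement's English description precedes it below -/
import Mathlib

section
/- Let B be the symmetric bilinear form on ℤ⁴ with basis e₁, e₂, f₁, f₂ determined by B(e₁,e₁) = B(e₂,e₂) = B(f₁,f₁) = B(f₂,f₂) = 0, B(e₁,e₂) = −1, B(f₁,f₂) = 1, B(eᵢ,fⱼ) = 0. Let a, b, c be positive integers, v = ac·e₁ + bc·e₂ + abc²·f₁ + f₂, v⊥ = {ξ : B(ξ,v) = 0}, α = e₁ + bc·f₁, β = e₂ + ac·f₁. Then: (1) B induces a well-defined symmetric bilinear form B̄ on the quotient ℤ-module v⊥/ℤv with B̄(x mod ℤv, y mod ℤv) = B(x,y); (2) v⊥/ℤv is free of rank 2 with basis ᾱ = α mod ℤv, β̄ = β mod ℤv; (3) B̄(ᾱ,ᾱ) = B̄(β̄,β̄) = 0 and B̄(ᾱ,β̄) = −1; in particular v⊥/ℤv with B̄ is isometric to the even unimodular hyperbolic plane U. -/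
/-- The symmetric bilinear form on `ℤ⁴` (coordinates `e₁, e₂, f₁, f₂`) determined by
`B(e₁,e₁) = B(e₂,e₂) = B(f₁,f₁) = B(f₂,f₂) = 0`, `B(e₁,e₂) = −1`, `B(f₁,f₂) = 1`,
and `B(eᵢ,fⱼ) = 0`. -/
def B4 (x y : Fin 4 → ℤ) : ℤ :=
  -(x 0 * y 1) - x 1 * y 0 + x 2 * y 3 + x 3 * y 2

/-- The orthogonal complement `v⊥ = {ξ ∈ ℤ⁴ : B(ξ,v) = 0}`, as a submodule of `ℤ⁴`. -/
def Vperp (v : Fin 4 → ℤ) : Submodule ℤ (Fin 4 → ℤ) where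
  carrier := {ξ | B4 ξ v = 0}
  add_mem' := by
    intro x y hx hy
    simp only [Set.mem_setOf_eq, B4, Pi.add_apply] at *
    linarith
  zero_mem' := by simp [B4]
  smul_mem' := by
    intro k x hx
    simp only [Set.mem_setOf_eq, B4, Pi.smul_apply, smul_eq_mul] at *
    linear_combination k * hx

lemma mem_Vperp (v ξ : Fin 4 → ℤ) : ξ ∈ Vperp v ↔ B4 ξ v = 0 := Iff.rfl

/-- The Mukai vector `v = ac·e₁ + bc·e₂ + abc²·f₁ + f₂`. -/
def vMuk (a b c : ℤ) : Fin 4 → ℤ := ![a * c, b * c, a * b * c ^ 2, 1]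

lemma vMuk_mem (a b c : ℤ) : vMuk a b c ∈ Vperp (vMuk a b c) := by
  show B4 _ _ = 0
  simp [B4, vMuk]
  ring

/-- `α = e₁ + bc·f₁` as an element of `v⊥`. -/
def αelt (a b c : ℤ) : Vperp (vMuk a b c) :=
  ⟨![1, 0, b * c, 0], by show B4 _ _ = 0; simp [B4, vMuk]⟩

/-- `β = e₂ + ac·f₁` as an element of `v⊥`. -/
def βelt (a b c : ℤ) : Vperp (vMuk a b c) :=
  ⟨![0, 1, a * c, 0], by show B4 _ _ = 0; simp [B4, vMuk]⟩

/-- The submodule `ℤv ⊆ v⊥`. -/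
def Zv (a b c : ℤ) : Submodule ℤ (Vperp (vMuk a b c)) :=
  Submodule.span ℤ {(⟨vMuk a b c, vMuk_mem a b c⟩ : Vperp (vMuk a b c))}

/-- The quotient `v⊥/ℤv`. -/
abbrev Qspace (a b c : ℤ) := Vperp (vMuk a b c) ⧸ Zv a b c

/-- The quotient map `v⊥ → v⊥/ℤv`. -/
def qmk (a b c : ℤ) (x : Vperp (vMuk a b c)) : Qspace a b c :=
  Submodule.Quotient.mk x

/-- The functional `ξ ↦ ξ i - v i * ξ 3` on `v⊥/ℤv`, where `v` has last coordinate `1`. For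
`i = 0, 1` these are the coordinates with respect to `ᾱ, β̄`. -/
def quotCoord (a b c : ℤ) (i : Fin 4) : Qspace a b c →ₗ[ℤ] ℤ :=
  (Zv a b c).liftQ
    ((LinearMap.proj i - vMuk a b c i • LinearMap.proj 3) ∘ₗ (Vperp (vMuk a b c)).subtype) <| by
    rw [Zv, Submodule.span_le, Set.singleton_subset_iff, SetLike.mem_coe, LinearMap.mem_ker]
    change vMuk a b c i - vMuk a b c i * 1 = 0
    ring

lemma quotCoord_qmk (a b c : ℤ) (i : Fin 4) (x : Vperp (vMuk a b c)) :
    quotCoord a b c i (qmk a b c x) = (x : Fin 4 → ℤ) i - vMuk a b c i * (x : Fin 4 → ℤ) 3 :=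
  rfl

lemma apply_two_of_mem_Vperp {a b c : ℤ} (x : Vperp (vMuk a b c)) :
    (x : Fin 4 → ℤ) 2 = b * c * (x : Fin 4 → ℤ) 0 + a * c * (x : Fin 4 → ℤ) 1
      - a * b * c ^ 2 * (x : Fin 4 → ℤ) 3 := by
  have h := (mem_Vperp _ _).1 x.2
  simp only [B4, vMuk, Matrix.cons_val] at h
  linear_combination h

lemma qmk_eq_quotCoord_smul_add (a b c : ℤ) (q : Qspace a b c) :
    q = quotCoord a b c 0 q • qmk a b c (αelt a b c)
      + quotCoord a b c 1 q • qmk a b c (βelt a b c) := by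
  obtain ⟨x, rfl⟩ := Submodule.Quotient.mk_surjective _ q
  change qmk a b c x = quotCoord a b c 0 (qmk a b c x) • qmk a b c (αelt a b c)
    + quotCoord a b c 1 (qmk a b c x) • qmk a b c (βelt a b c)
  simp only [quotCoord_qmk]
  refine (Submodule.Quotient.eq (Zv a b c) (y := _ • αelt a b c + _ • βelt a b c)).2 ?_
  refine Submodule.mem_span_singleton.2 ⟨(x : Fin 4 → ℤ) 3, ?_⟩
  have h := apply_two_of_mem_Vperp x
  ext i
  simp only [Submodule.coe_smul, Submodule.coe_sub, Submodule.coe_add, αelt, βelt]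
  fin_cases i <;> simp [vMuk]
  · ring
  · ring
  · linear_combination -h

/-- The form on `v⊥/ℤv` induced by `B4`. -/
def quotForm (a b c : ℤ) : Qspace a b c →ₗ[ℤ] Qspace a b c →ₗ[ℤ] ℤ :=
  -(quotCoord a b c 0).smulRight (quotCoord a b c 1)
    - (quotCoord a b c 1).smulRight (quotCoord a b c 0)

lemma quotForm_apply (a b c : ℤ) (q q' : Qspace a b c) :
    quotForm a b c q q' = -(quotCoord a b c 0 q * quotCoord a b c 1 q')
      - quotCoord a b c 1 q * quotCoord a b c 0 q' := by
  simp [quotForm]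

lemma quotForm_qmk (a b c : ℤ) (x y : Vperp (vMuk a b c)) :
    quotForm a b c (qmk a b c x) (qmk a b c y) = B4 (x : Fin 4 → ℤ) (y : Fin 4 → ℤ) := by
  rw [quotForm_apply]
  simp only [quotCoord_qmk, B4, apply_two_of_mem_Vperp, vMuk, Matrix.cons_val]
  ring

/-- For `v = ac·e₁ + bc·e₂ + abc²·f₁ + f₂` (`a, b, c` positive integers):
(1) `B` induces a well-defined symmetric bilinear form `B̄` on the quotient `v⊥/ℤv`
with `B̄(x mod ℤv, y mod ℤv) = B(x,y)`;
(2) `v⊥/ℤv` is free of rank 2 with basis `ᾱ = α mod ℤv`, `β̄ = β mod ℤv`;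
(3) `B̄(ᾱ,ᾱ) = B̄(β̄,β̄) = 0` and `B̄(ᾱ,β̄) = −1`; in particular `(v⊥/ℤv, B̄)` is
isometric to the even unimodular hyperbolic plane `U`. -/
theorem stmt8 (a b c : ℤ) (ha : 0 < a) (hb : 0 < b) (hc : 0 < c) :
    ∃ Bbar : Qspace a b c →ₗ[ℤ] Qspace a b c →ₗ[ℤ] ℤ,
      (∀ x y : Vperp (vMuk a b c),
        Bbar (qmk a b c x) (qmk a b c y) = B4 (x : Fin 4 → ℤ) (y : Fin 4 → ℤ)) ∧
      (∀ q q' : Qspace a b c, Bbar q q' = Bbar q' q) ∧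
      (∀ q : Qspace a b c, ∃! cc : ℤ × ℤ,
        q = cc.1 • qmk a b c (αelt a b c) + cc.2 • qmk a b c (βelt a b c)) ∧
      Bbar (qmk a b c (αelt a b c)) (qmk a b c (αelt a b c)) = 0 ∧
      Bbar (qmk a b c (βelt a b c)) (qmk a b c (βelt a b c)) = 0 ∧
      Bbar (qmk a b c (αelt a b c)) (qmk a b c (βelt a b c)) = -1 := by
  refine ⟨quotForm a b c, quotForm_qmk a b c, fun q q' => ?_, fun q => ?_, ?_, ?_, ?_⟩
  · rw [quotForm_apply, quotForm_apply]
    ring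
  · refine ⟨(quotCoord a b c 0 q, quotCoord a b c 1 q), qmk_eq_quotCoord_smul_add a b c q, ?_⟩
    rintro ⟨m, n⟩ rfl
    simp [quotCoord_qmk, αelt, βelt]
  all_goals
    rw [quotForm_qmk]
    simp [B4, αelt, βelt]
end

section
/- With the notation of the hyperbolic-planes model: B the bilinear form on ℤ⁴ with B(e₁,e₂) = −1, B(f₁,f₂) = 1, all other pairings of basis vectors zero; a, b, c positive integers with gcd(a,b) = 1; v = ac·e₁ + bc·e₂ + abc²·f₁ + f₂; v⊥ its orthogonal complement; ᾱ, β̄ the classes of α = e₁ + bc·f₁, β = e₂ + ac·f₁ in v⊥/ℤv; t = −abc²·f₁ + f₂; and B̄ the induced form on v⊥/ℤv. Then: (1) t mod ℤv = −ac·ᾱ − bc·β̄, so t̃ = −a·ᾱ − b·β̄ satisfies c·t̃ = t mod ℤv; (2) B̄(t̃,t̃) = −2ab; (3) the orthogonal complement of ℤ·t̃ in (v⊥/ℤv, B̄) is ℤ·h where h = a·ᾱ − b·β̄, and B̄(h,h) = 2ab. -/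
/-- `t = −abc²·f₁ + f₂` as an element of `v⊥`. -/
def telt (a b c : ℤ) : Vperp (vMuk a b c) :=
  ⟨![0, 0, -(a * b * c ^ 2), 1], by show B4 _ _ = 0; simp [B4, vMuk]⟩

/-- The class of `ξ ∈ v⊥` in terms of `ᾱ` and `β̄`. -/
lemma qmk_eq_smul_add_smul (a b c : ℤ) (ξ : Vperp (vMuk a b c)) :
    qmk a b c ξ =
      ((ξ : Fin 4 → ℤ) 0 - (ξ : Fin 4 → ℤ) 3 * (a * c)) • qmk a b c (αelt a b c) +
      ((ξ : Fin 4 → ℤ) 1 - (ξ : Fin 4 → ℤ) 3 * (b * c)) • qmk a b c (βelt a b c) := by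
  obtain ⟨ξ, hξ⟩ := ξ
  have hperp : B4 ξ (vMuk a b c) = 0 := hξ
  simp only [qmk, ← Submodule.Quotient.mk_smul, ← Submodule.Quotient.mk_add]
  rw [Submodule.Quotient.eq, Zv, Submodule.mem_span_singleton]
  refine ⟨ξ 3, Subtype.ext ?_⟩
  change ξ 3 • vMuk a b c = ξ - ((ξ 0 - ξ 3 * (a * c)) • ![1, 0, b * c, 0] +
    (ξ 1 - ξ 3 * (b * c)) • ![0, 1, a * c, 0])
  simp [B4, vMuk] at hperp
  ext i
  fin_cases i <;> simp [vMuk]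
  linear_combination -hperp

/-- The induced form on `v⊥/ℤv` is minus the hyperbolic plane in the basis `ᾱ, β̄`. -/
lemma induced_form_apply (a b c : ℤ)
    (Bbar : Qspace a b c →ₗ[ℤ] Qspace a b c →ₗ[ℤ] ℤ)
    (hBbar : ∀ x y : Vperp (vMuk a b c),
      Bbar (qmk a b c x) (qmk a b c y) = B4 (x : Fin 4 → ℤ) (y : Fin 4 → ℤ))
    (x y z w : ℤ) :
    Bbar (x • qmk a b c (αelt a b c) + y • qmk a b c (βelt a b c))
      (z • qmk a b c (αelt a b c) + w • qmk a b c (βelt a b c)) = -(x * w + y * z) := by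
  simp only [map_add, map_smul, LinearMap.add_apply, LinearMap.smul_apply, hBbar]
  simp [B4, αelt, βelt]
  ring

/-- If `gcd(a,b) = 1` and `a ≠ 0`, the solutions of `xb + ya = 0` are the multiples of
`(a, -b)`. -/
lemma exists_eq_mul_of_mul_add_mul_eq_zero {a b x y : ℤ} (ha : a ≠ 0)
    (hab : Int.gcd a b = 1) (h : x * b + y * a = 0) :
    ∃ k : ℤ, x = k * a ∧ y = -(k * b) := by
  have hdvd : a ∣ x :=
    (Int.isCoprime_iff_gcd_eq_one.mpr hab).dvd_of_dvd_mul_right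
      ⟨-y, by linear_combination h⟩
  obtain ⟨k, rfl⟩ := hdvd
  exact ⟨k, mul_comm _ _, mul_left_cancel₀ ha (by linear_combination h)⟩

/-- With `gcd(a,b) = 1`, `ᾱ, β̄` the classes of `α = e₁ + bc·f₁`, `β = e₂ + ac·f₁` in
`v⊥/ℤv`, `t = −abc²·f₁ + f₂`, and `B̄` the induced form on `v⊥/ℤv`:
(1) `t mod ℤv = −ac·ᾱ − bc·β̄`, so `t̃ = −a·ᾱ − b·β̄` satisfies `c·t̃ = t mod ℤv`;
(2) `B̄(t̃,t̃) = −2ab`;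
(3) the orthogonal complement of `ℤ·t̃` in `(v⊥/ℤv, B̄)` is `ℤ·h` where
`h = a·ᾱ − b·β̄`, and `B̄(h,h) = 2ab`. -/
theorem stmt9 (a b c : ℤ) (ha : 0 < a) (hb : 0 < b) (hc : 0 < c)
    (hab : Int.gcd a b = 1)
    (Bbar : Qspace a b c →ₗ[ℤ] Qspace a b c →ₗ[ℤ] ℤ)
    (hBbar : ∀ x y : Vperp (vMuk a b c),
      Bbar (qmk a b c x) (qmk a b c y) = B4 (x : Fin 4 → ℤ) (y : Fin 4 → ℤ)) :
    (qmk a b c (telt a b c)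
        = -(a * c) • qmk a b c (αelt a b c) - (b * c) • qmk a b c (βelt a b c)) ∧
    (c • (-a • qmk a b c (αelt a b c) - b • qmk a b c (βelt a b c))
        = qmk a b c (telt a b c)) ∧
    Bbar (-a • qmk a b c (αelt a b c) - b • qmk a b c (βelt a b c))
        (-a • qmk a b c (αelt a b c) - b • qmk a b c (βelt a b c)) = -(2 * a * b) ∧
    (∀ q : Qspace a b c,
      Bbar q (-a • qmk a b c (αelt a b c) - b • qmk a b c (βelt a b c)) = 0 ↔
      ∃ k : ℤ, q = k • (a • qmk a b c (αelt a b c) - b • qmk a b c (βelt a b c))) ∧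
    Bbar (a • qmk a b c (αelt a b c) - b • qmk a b c (βelt a b c))
        (a • qmk a b c (αelt a b c) - b • qmk a b c (βelt a b c)) = 2 * a * b := by
  have form := induced_form_apply a b c Bbar hBbar
  have ht : qmk a b c (telt a b c)
      = -(a * c) • qmk a b c (αelt a b c) - (b * c) • qmk a b c (βelt a b c) := by
    rw [qmk_eq_smul_add_smul a b c (telt a b c)]
    simp [telt, sub_eq_add_neg]
  have htilde : -a • qmk a b c (αelt a b c) - b • qmk a b c (βelt a b c)
      = (-a) • qmk a b c (αelt a b c) + (-b) • qmk a b c (βelt a b c) := by module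
  have hh : a • qmk a b c (αelt a b c) - b • qmk a b c (βelt a b c)
      = a • qmk a b c (αelt a b c) + (-b) • qmk a b c (βelt a b c) := by module
  refine ⟨ht, ?_, ?_, fun q => ⟨fun hq => ?_, ?_⟩, ?_⟩
  · rw [ht]
    module
  · rw [htilde, form]
    ring
  · obtain ⟨ξ, rfl⟩ := Submodule.Quotient.mk_surjective _ q
    change Bbar (qmk a b c ξ) _ = 0 at hq
    change ∃ k : ℤ, qmk a b c ξ = _
    rw [qmk_eq_smul_add_smul] at hq ⊢
    rw [htilde, form] at hq
    obtain ⟨k, hx, hy⟩ := exists_eq_mul_of_mul_add_mul_eq_zero ha.ne' hab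
      (x := (ξ : Fin 4 → ℤ) 0 - (ξ : Fin 4 → ℤ) 3 * (a * c))
      (y := (ξ : Fin 4 → ℤ) 1 - (ξ : Fin 4 → ℤ) 3 * (b * c)) (by linear_combination hq)
    refine ⟨k, ?_⟩
    rw [hx, hy]
    module
  · rintro ⟨k, rfl⟩
    rw [htilde, hh, map_smul, LinearMap.smul_apply, form, smul_eq_mul]
    ring
  · rw [hh, form]
    ring
end

section
/- Let B be the symmetric bilinear form on ℤ⁴ with basis e₁, e₂, f₁, f₂ determined by B(e₁,e₂) = −1, B(f₁,f₂) = 1, and all other pairings of basis vectors zero. Let a, b, c, d be positive integers with gcd(d, bc) = 1, and set v₁ = d²ac·e₁ + bc·e₂ + dabc²·f₁ + d·f₂. Then: (1) an element ξ₁ = x₁e₁ + y₁e₂ + z₁f₁ + w₁f₂ satisfies B(ξ₁,v₁) = 0 if and only if d | x₁ and z₁ = bc·(x₁/d) + dac·y₁ − abc²·w₁; (2) α₁ = d·e₁ + bc·f₁, β₁ = e₂ + dac·f₁, t = −abc²·f₁ + f₂ form a ℤ-basis of v₁⊥ = {ξ : B(ξ,v₁) = 0}; (3) v₁ = dac·α₁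 + bc·β₁ + d·t; (4) B(α₁,α₁) = B(β₁,β₁) = 0 and B(α₁,β₁) = −d. -/
theorem B4_vec_eq_zero_iff {a b c d : ℤ} (hd : d ≠ 0) (hcop : Int.gcd d (b * c) = 1)
    (x y z w : ℤ) :
    B4 ![x, y, z, w] ![d ^ 2 * a * c, b * c, d * a * b * c ^ 2, d] = 0 ↔
      ∃ x' : ℤ, x = d * x' ∧ z = b * c * x' + d * a * c * y - a * b * c ^ 2 * w := by
  simp only [B4, Matrix.cons_val]
  constructor
  · intro h
    have hdvd : d ∣ x * (b * c) :=
      ⟨z + w * (a * b * c ^ 2) - y * (d * a * c), by linear_combination -h⟩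
    obtain ⟨x', rfl⟩ := (Int.isCoprime_iff_gcd_eq_one.mpr hcop).dvd_of_dvd_mul_right hdvd
    exact ⟨x', rfl, mul_left_cancel₀ hd (by linear_combination h)⟩
  · rintro ⟨x', rfl, rfl⟩
    ring

/-- For positive integers `a, b, c, d` with `gcd(d, bc) = 1` and
`v₁ = d²ac·e₁ + bc·e₂ + dabc²·f₁ + d·f₂`:
(1) `ξ₁ = x₁e₁ + y₁e₂ + z₁f₁ + w₁f₂` satisfies `B(ξ₁,v₁) = 0` iff `d ∣ x₁` and
`z₁ = bc(x₁/d) + dac·y₁ − abc²·w₁`;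
(2) `α₁ = d·e₁ + bc·f₁`, `β₁ = e₂ + dac·f₁`, `t = −abc²·f₁ + f₂` form a ℤ-basis of `v₁⊥`;
(3) `v₁ = dac·α₁ + bc·β₁ + d·t`;
(4) `B(α₁,α₁) = B(β₁,β₁) = 0` and `B(α₁,β₁) = −d`. -/
theorem stmt10 (a b c d : ℤ) (ha : 0 < a) (hb : 0 < b) (hc : 0 < c) (hd : 0 < d)
    (hcop : Int.gcd d (b * c) = 1)
    (v₁ α₁ β₁ t : Fin 4 → ℤ)
    (hv₁ : v₁ = ![d ^ 2 * a * c, b * c, d * a * b * c ^ 2, d])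
    (hα₁ : α₁ = ![d, 0, b * c, 0])
    (hβ₁ : β₁ = ![0, 1, d * a * c, 0])
    (ht : t = ![0, 0, -(a * b * c ^ 2), 1]) :
    (∀ x₁ y₁ z₁ w₁ : ℤ,
      B4 ![x₁, y₁, z₁, w₁] v₁ = 0 ↔
      ∃ x' : ℤ, x₁ = d * x' ∧
        z₁ = b * c * x' + d * a * c * y₁ - a * b * c ^ 2 * w₁) ∧
    (B4 α₁ v₁ = 0 ∧ B4 β₁ v₁ = 0 ∧ B4 t v₁ = 0) ∧
    (∀ ξ : Fin 4 → ℤ, B4 ξ v₁ = 0 →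
      ∃! cc : ℤ × ℤ × ℤ, ξ = cc.1 • α₁ + cc.2.1 • β₁ + cc.2.2 • t) ∧
    v₁ = (d * a * c) • α₁ + (b * c) • β₁ + d • t ∧
    B4 α₁ α₁ = 0 ∧ B4 β₁ β₁ = 0 ∧ B4 α₁ β₁ = -d := by
  subst hv₁ hα₁ hβ₁ ht
  refine ⟨B4_vec_eq_zero_iff hd.ne' hcop, ⟨?_, ?_, ?_⟩, ?_, ?_, ?_, ?_, ?_⟩
  · simp only [B4, Matrix.cons_val]
    ring
  · simp only [B4, Matrix.cons_val]
    ring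
  · simp only [B4, Matrix.cons_val]
    ring
  · intro ξ hξ
    obtain ⟨x', hx, hz⟩ := (B4_vec_eq_zero_iff hd.ne' hcop (ξ 0) (ξ 1) (ξ 2) (ξ 3)).mp hξ
    refine ⟨(x', ξ 1, ξ 3), ?_, ?_⟩
    · ext i
      fin_cases i
      · simp [hx, mul_comm]
      · simp
      · simp only [Fin.reduceFinMk, hz, Pi.add_apply, Pi.smul_apply, smul_eq_mul, Matrix.cons_val]
        ring
      · simp
    · rintro ⟨p, q, r⟩ h
      have h0 := congrFun h 0
      have h1 := congrFun h 1
      have h3 := congrFun h 3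
      simp only [Pi.add_apply, Pi.smul_apply, smul_eq_mul, Matrix.cons_val] at h0 h1 h3
      have hp : p = x' := mul_left_cancel₀ hd.ne' (by linear_combination hx - h0)
      simp [hp, h1, h3]
  · ext i
    fin_cases i <;> simp <;> ring
  · simp [B4]
  · simp [B4]
  · simp [B4]
end

section
/- With the notation of the previous model: B on ℤ⁴ with B(e₁,e₂) = −1, B(f₁,f₂) = 1, other basis pairings zero; a, b, c, d positive integers with gcd(d,bc) = 1; v₁ = d²ac·e₁ + bc·e₂ + dabc²·f₁ + d·f₂; v₁⊥ its orthogonal complement with basis α₁ = d·e₁ + bc·f₁, β₁ = e₂ + dac·f₁, t = −abc²·f₁ + f₂; and B̄ the induced symmetric bilinear form on v₁⊥/ℤv₁. Then: (1) there exist (unique) elements β̃₁ and t̃₁ of v₁⊥/ℤv₁ with d·β̃₁ = β₁ mod ℤv₁ and c·t̃₁ = t mod ℤv₁; (2) ᾱ₁ = α₁ mod ℤv₁ and β̃₁ form a ℤ-basis of v₁⊥/ℤv₁ with B̄(ᾱ₁,ᾱ₁) = B̄(β̃₁,β̃₁) = 0 and B̄(ᾱ₁,β̃₁) = −1; (3)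 a·ᾱ₁ + b·β̃₁ + t̃₁ = 0. -/
/-- The Mukai vector `v₁ = d²ac·e₁ + bc·e₂ + dabc²·f₁ + d·f₂`. -/
def vMuk₁ (a b c d : ℤ) : Fin 4 → ℤ := ![d ^ 2 * a * c, b * c, d * a * b * c ^ 2, d]

lemma vMuk₁_mem (a b c d : ℤ) : vMuk₁ a b c d ∈ Vperp (vMuk₁ a b c d) := by
  show B4 _ _ = 0
  simp [B4, vMuk₁]
  ring

/-- `α₁ = d·e₁ + bc·f₁` as an element of `v₁⊥`. -/
def α₁elt (a b c d : ℤ) : Vperp (vMuk₁ a b c d) :=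
  ⟨![d, 0, b * c, 0], by show B4 _ _ = 0; simp [B4, vMuk₁]; ring⟩

/-- `β₁ = e₂ + dac·f₁` as an element of `v₁⊥`. -/
def β₁elt (a b c d : ℤ) : Vperp (vMuk₁ a b c d) :=
  ⟨![0, 1, d * a * c, 0], by show B4 _ _ = 0; simp [B4, vMuk₁]; ring⟩

/-- `t = −abc²·f₁ + f₂` as an element of `v₁⊥`. -/
def telt₁ (a b c d : ℤ) : Vperp (vMuk₁ a b c d) :=
  ⟨![0, 0, -(a * b * c ^ 2), 1], by show B4 _ _ = 0; simp [B4, vMuk₁]; ring⟩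

/-- The submodule `ℤv₁ ⊆ v₁⊥`. -/
def Zv₁ (a b c d : ℤ) : Submodule ℤ (Vperp (vMuk₁ a b c d)) :=
  Submodule.span ℤ {(⟨vMuk₁ a b c d, vMuk₁_mem a b c d⟩ : Vperp (vMuk₁ a b c d))}

/-- The quotient `v₁⊥/ℤv₁`. -/
abbrev Qspace₁ (a b c d : ℤ) := Vperp (vMuk₁ a b c d) ⧸ Zv₁ a b c d

/-- The quotient map `v₁⊥ → v₁⊥/ℤv₁`. -/
def qmk₁ (a b c d : ℤ) (x : Vperp (vMuk₁ a b c d)) : Qspace₁ a b c d :=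
  Submodule.Quotient.mk x

/-- Spanning of `v₁⊥` by `α₁`, `β₁`, `t`. -/
lemma exists_eq_α₁_β₁_t (a b c d : ℤ) (hd : d ≠ 0) (hcop : IsCoprime d (b * c))
    (ξ : Vperp (vMuk₁ a b c d)) :
    ∃ x y z : ℤ, ξ = x • α₁elt a b c d + y • β₁elt a b c d + z • telt₁ a b c d := by
  obtain ⟨ξ, hξ⟩ := ξ
  have h : B4 ξ (vMuk₁ a b c d) = 0 := hξ
  simp [B4, vMuk₁] at h
  obtain ⟨k, hk⟩ : d ∣ ξ 0 := hcop.dvd_of_dvd_mul_right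
    ⟨ξ 2 + ξ 3 * (a * b * c ^ 2) - ξ 1 * (d * a * c), by linear_combination -h⟩
  have h2 : ξ 2 = k * (b * c) + ξ 1 * (d * a * c) - ξ 3 * (a * b * c ^ 2) := by
    refine mul_left_cancel₀ hd ?_
    linear_combination h + (b * c) * hk
  refine ⟨k, ξ 1, ξ 3, Subtype.ext <| funext fun i => ?_⟩
  fin_cases i
  · simp [α₁elt, β₁elt, telt₁, hk, mul_comm]
  · simp [α₁elt, β₁elt, telt₁]
  · simp [α₁elt, β₁elt, telt₁, h2, sub_eq_add_neg]
  · simp [α₁elt, β₁elt, telt₁]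

/-- The expression of `v₁` in the basis `α₁`, `β₁`, `t`, read modulo `ℤv₁`. -/
lemma qmk₁_relation (a b c d : ℤ) :
    (d * a * c) • qmk₁ a b c d (α₁elt a b c d) + (b * c) • qmk₁ a b c d (β₁elt a b c d)
      + d • qmk₁ a b c d (telt₁ a b c d) = 0 := by
  refine (Submodule.Quotient.mk_eq_zero (Zv₁ a b c d) (x := (d * a * c) • α₁elt a b c d
    + (b * c) • β₁elt a b c d + d • telt₁ a b c d)).2 ?_
  refine Submodule.mem_span_singleton.2 ⟨1, Subtype.ext <| funext fun i => ?_⟩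
  change 1 * vMuk₁ a b c d i = (d * a * c) * (α₁elt a b c d).1 i
    + (b * c) * (β₁elt a b c d).1 i + d * (telt₁ a b c d).1 i
  fin_cases i <;> simp [α₁elt, β₁elt, telt₁, vMuk₁] <;> ring

/-- Two elements of a module with a bilinear form whose Gram matrix is the negative of the
hyperbolic plane have coordinates determined by the form. -/
lemma coords_eq_of_hyperbolic {R M : Type*} [CommRing R] [AddCommGroup M]
    [Module R M] (B : M →ₗ[R] M →ₗ[R] R) {α β : M} (hαα : B α α = 0) (hββ : B β β = 0)
    (hαβ : B α β = -1) (hβα : B β α = -1) (m n : R) :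
    B (m • α + n • β) β = -m ∧ B (m • α + n • β) α = -n := by
  constructor <;>
    simp only [map_add, map_smul, LinearMap.add_apply, LinearMap.smul_apply, hαα, hββ, hαβ, hβα,
      smul_eq_mul] <;> ring

/-- Dividing `β` by `d` and `t` by `c` in a module with the relation
`dac • α + bc • β + d • t = 0`. -/
lemma exists_smul_eq_of_relation {R M : Type*} [CommRing R] [AddCommGroup M] [Module R M]
    {a b c d : R}
    (hcop : IsCoprime d (b * c)) {α β t : M}
    (h : (d * a * c) • α + (b * c) • β + d • t = 0) :
    ∃ βt : M, d • βt = β ∧ c • (-(a • α + b • βt)) = t := by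
  obtain ⟨u, w, huw⟩ := hcop
  refine ⟨u • β - w • ((a * c) • α + t), ?_, ?_⟩
  · linear_combination (norm := module) (-w) • h + huw • β
  · linear_combination (norm := module) (-u) • h + huw • (t + (a * c) • α)

/-- For positive integers `a, b, c, d` with `gcd(d,bc) = 1`,
`v₁ = d²ac·e₁ + bc·e₂ + dabc²·f₁ + d·f₂`, with `α₁ = d·e₁ + bc·f₁`,
`β₁ = e₂ + dac·f₁`, `t = −abc²·f₁ + f₂` in `v₁⊥`, and `B̄` the induced form on
`v₁⊥/ℤv₁`:
(1) there exist unique `β̃₁`, `t̃₁` in `v₁⊥/ℤv₁` with `d·β̃₁ = β₁ mod ℤv₁` and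
`c·t̃₁ = t mod ℤv₁`;
(2) `ᾱ₁ = α₁ mod ℤv₁` and `β̃₁` form a ℤ-basis of `v₁⊥/ℤv₁` with
`B̄(ᾱ₁,ᾱ₁) = B̄(β̃₁,β̃₁) = 0` and `B̄(ᾱ₁,β̃₁) = −1`;
(3) `a·ᾱ₁ + b·β̃₁ + t̃₁ = 0`. -/
theorem stmt11 (a b c d : ℤ) (ha : 0 < a) (hb : 0 < b) (hc : 0 < c) (hd : 0 < d)
    (hcop : Int.gcd d (b * c) = 1)
    (Bbar : Qspace₁ a b c d →ₗ[ℤ] Qspace₁ a b c d →ₗ[ℤ] ℤ)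
    (hBbar : ∀ x y : Vperp (vMuk₁ a b c d),
      Bbar (qmk₁ a b c d x) (qmk₁ a b c d y) = B4 (x : Fin 4 → ℤ) (y : Fin 4 → ℤ)) :
    (∃! βt : Qspace₁ a b c d, d • βt = qmk₁ a b c d (β₁elt a b c d)) ∧
    (∃! tt : Qspace₁ a b c d, c • tt = qmk₁ a b c d (telt₁ a b c d)) ∧
    (∀ βt tt : Qspace₁ a b c d,
      d • βt = qmk₁ a b c d (β₁elt a b c d) →
      c • tt = qmk₁ a b c d (telt₁ a b c d) →
      (∀ q : Qspace₁ a b c d, ∃! cc : ℤ × ℤ,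
        q = cc.1 • qmk₁ a b c d (α₁elt a b c d) + cc.2 • βt) ∧
      Bbar (qmk₁ a b c d (α₁elt a b c d)) (qmk₁ a b c d (α₁elt a b c d)) = 0 ∧
      Bbar βt βt = 0 ∧
      Bbar (qmk₁ a b c d (α₁elt a b c d)) βt = -1 ∧
      a • qmk₁ a b c d (α₁elt a b c d) + b • βt + tt = 0) := by
  have hcop' : IsCoprime d (b * c) := Int.isCoprime_iff_gcd_eq_one.2 hcop
  set α := qmk₁ a b c d (α₁elt a b c d) with hα
  set β := qmk₁ a b c d (β₁elt a b c d) with hβ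
  set t := qmk₁ a b c d (telt₁ a b c d) with ht
  have hαα : Bbar α α = 0 := by
    rw [hα, hBbar]; simp [B4, α₁elt]
  have hββ : Bbar β β = 0 := by
    rw [hβ, hBbar]; simp [B4, β₁elt]
  have hαβ : Bbar α β = -d := by
    rw [hα, hβ, hBbar]; simp [B4, α₁elt, β₁elt]
  have hβα : Bbar β α = -d := by
    rw [hα, hβ, hBbar]; simp [B4, α₁elt, β₁elt]
  have gram : ∀ βt, d • βt = β → Bbar βt βt = 0 ∧ Bbar α βt = -1 ∧ Bbar βt α = -1 := by
    intro βt h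
    rw [← h] at hββ hαβ hβα
    simp only [map_smul, LinearMap.smul_apply, smul_eq_mul] at hββ hαβ hβα
    refine ⟨by simpa [hd.ne'] using hββ, ?_, ?_⟩ <;> refine mul_left_cancel₀ hd.ne' ?_ <;>
      linarith
  obtain ⟨β₀, hβ₀, ht₀⟩ := exists_smul_eq_of_relation hcop' (qmk₁_relation a b c d)
  rw [← hα] at ht₀
  have span : ∀ q : Qspace₁ a b c d, ∃ m n : ℤ, q = m • α + n • β₀ := by
    intro q
    obtain ⟨ξ, rfl⟩ := Submodule.Quotient.mk_surjective _ q
    obtain ⟨x, y, z, rfl⟩ := exists_eq_α₁_β₁_t a b c d hd.ne' hcop' ξ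
    refine ⟨x - z * c * a, y * d - z * c * b, ?_⟩
    change x • α + y • β + z • t = _
    rw [hβ, ht, ← hβ₀, ← ht₀]
    module
  obtain ⟨g₁, g₂, g₃⟩ := gram β₀ hβ₀
  have cancel : ∀ k : ℤ, k ≠ 0 → ∀ p q : Qspace₁ a b c d, k • p = k • q → p = q := by
    intro k hk p q h
    obtain ⟨m, n, rfl⟩ := span p
    obtain ⟨m', n', rfl⟩ := span q
    have e₁ := congrArg (fun r => Bbar r β₀) h
    have e₂ := congrArg (fun r => Bbar r α) h
    obtain ⟨c₁, c₂⟩ := coords_eq_of_hyperbolic Bbar hαα g₁ g₂ g₃ m n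
    obtain ⟨c₁', c₂'⟩ := coords_eq_of_hyperbolic Bbar hαα g₁ g₂ g₃ m' n'
    simp only [map_smul, LinearMap.smul_apply, smul_eq_mul, c₁, c₂, c₁', c₂'] at e₁ e₂
    rw [neg_injective (mul_left_cancel₀ hk e₁), neg_injective (mul_left_cancel₀ hk e₂)]
  refine ⟨⟨β₀, hβ₀, fun y hy => cancel d hd.ne' _ _ (hy.trans hβ₀.symm)⟩,
    ⟨_, ht₀, fun y hy => cancel c hc.ne' _ _ (hy.trans ht₀.symm)⟩, ?_⟩
  intro βt tt hβt htt
  obtain rfl : βt = β₀ := cancel d hd.ne' _ _ (hβt.trans hβ₀.symm)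
  obtain rfl : tt = -(a • α + b • βt) := cancel c hc.ne' _ _ (htt.trans ht₀.symm)
  refine ⟨fun q => ?_, hαα, g₁, g₂, add_neg_cancel _⟩
  obtain ⟨m, n, rfl⟩ := span q
  refine ⟨(m, n), rfl, ?_⟩
  rintro ⟨m', n'⟩ h
  obtain ⟨c₁, c₂⟩ := coords_eq_of_hyperbolic Bbar hαα g₁ g₂ g₃ m n
  obtain ⟨c₁', c₂'⟩ := coords_eq_of_hyperbolic Bbar hαα g₁ g₂ g₃ m' n'
  rw [h] at c₁ c₂
  exact Prod.ext (neg_injective (c₁'.symm.trans c₁)) (neg_injective (c₂'.symm.trans c₂))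
end

section
/- With the notation of the two previous models (B on ℤ⁴ with B(e₁,e₂) = −1, B(f₁,f₂) = 1, other basis pairings zero; a, b, c, d positive integers with gcd(a,b) = 1 and gcd(d,bc) = 1; v = ac·e₁ + bc·e₂ + abc²·f₁ + f₂ and v₁ = d²ac·e₁ + bc·e₂ + dabc²·f₁ + d·f₂; ᾱ, β̄ the basis of v⊥/ℤv and ᾱ₁, β̃₁ the basis of v₁⊥/ℤv₁ constructed there; t̃ = −a·ᾱ − b·β̄ and t̃₁ = −a·ᾱ₁ − b·β̃₁): the ℤ-linear map φ : v⊥/ℤv → v₁⊥/ℤv₁ defined by φ(ᾱ) = ᾱ₁ and φ(β̄) = β̃₁ is an isometry of the induced bilinear forms, and φ(t̃) = t̃₁. -/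
@[simp] lemma coe_αelt (a b c : ℤ) : (αelt a b c : Fin 4 → ℤ) = ![1, 0, b * c, 0] := rfl

@[simp] lemma coe_βelt (a b c : ℤ) : (βelt a b c : Fin 4 → ℤ) = ![0, 1, a * c, 0] := rfl

@[simp] lemma coe_α₁elt (a b c d : ℤ) :
    (α₁elt a b c d : Fin 4 → ℤ) = ![d, 0, b * c, 0] := rfl

@[simp] lemma coe_β₁elt (a b c d : ℤ) :
    (β₁elt a b c d : Fin 4 → ℤ) = ![0, 1, d * a * c, 0] := rfl

lemma qmk_eq_iff (a b c : ℤ) (x y : Vperp (vMuk a b c)) :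
    qmk a b c x = qmk a b c y ↔ ∃ m : ℤ, ∀ i, m * vMuk a b c i = x.1 i - y.1 i := by
  unfold qmk
  rw [Submodule.Quotient.eq, Zv, Submodule.mem_span_singleton]
  simp [Subtype.ext_iff, funext_iff]

lemma qmk₁_eq_iff (a b c d : ℤ) (x y : Vperp (vMuk₁ a b c d)) :
    qmk₁ a b c d x = qmk₁ a b c d y ↔ ∃ m : ℤ, ∀ i, m * vMuk₁ a b c d i = x.1 i - y.1 i := by
  unfold qmk₁
  rw [Submodule.Quotient.eq, Zv₁, Submodule.mem_span_singleton]
  simp [Subtype.ext_iff, funext_iff]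

/-- The classes of `α` and `β` generate `v⊥/ℤv`. -/
lemma exists_eq_smul_add_smul (a b c : ℤ) (x : Qspace a b c) :
    ∃ p q : ℤ, x = p • qmk a b c (αelt a b c) + q • qmk a b c (βelt a b c) := by
  obtain ⟨w, rfl⟩ := Submodule.Quotient.mk_surjective _ x
  refine ⟨w.1 0 - a * c * w.1 3, w.1 1 - b * c * w.1 3, ?_⟩
  have hw : B4 w.1 (vMuk a b c) = 0 := w.2
  simp [B4, vMuk] at hw
  refine (qmk_eq_iff a b c w ((w.1 0 - a * c * w.1 3) • αelt a b c +
    (w.1 1 - b * c * w.1 3) • βelt a b c)).2 ⟨w.1 3, fun i => ?_⟩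
  simp only [Submodule.coe_add, Submodule.coe_smul, Pi.add_apply, Pi.smul_apply, smul_eq_mul, coe_αelt,
    coe_βelt]
  fin_cases i <;> simp [vMuk]
  · ring
  · ring
  · linear_combination -hw

/-- If `d` is coprime to `bc` and `d·β̃₁ = β₁` modulo `ℤv₁`, then the classes of `α₁` and `β̃₁`
generate `v₁⊥/ℤv₁`. -/
lemma exists_eq_smul_add_smul₁ (a b c d : ℤ) (hd : d ≠ 0) (hcop : IsCoprime d (b * c))
    (βt : Qspace₁ a b c d) (hβt : d • βt = qmk₁ a b c d (β₁elt a b c d))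
    (y : Qspace₁ a b c d) :
    ∃ p q : ℤ, y = p • qmk₁ a b c d (α₁elt a b c d) + q • βt := by
  obtain ⟨w, rfl⟩ := Submodule.Quotient.mk_surjective _ y
  obtain ⟨z, rfl⟩ := Submodule.Quotient.mk_surjective _ βt
  obtain ⟨m, hm⟩ := (qmk₁_eq_iff a b c d (d • z) (β₁elt a b c d)).1 hβt
  simp only [Submodule.coe_smul, Pi.smul_apply, smul_eq_mul, coe_β₁elt] at hm
  have hm0 := hm 0
  have hm1 := hm 1
  have hm2 := hm 2
  have hm3 := hm 3
  simp [vMuk₁] at hm0 hm1 hm2 hm3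
  have hw : B4 w.1 (vMuk₁ a b c d) = 0 := w.2
  simp [B4, vMuk₁] at hw
  obtain ⟨u, hu⟩ : d ∣ w.1 0 := hcop.dvd_of_dvd_mul_right
    ⟨w.1 2 + w.1 3 * (a * b * c ^ 2) - w.1 1 * (d * a * c), by linear_combination -hw⟩
  have hz0 : z.1 0 = m * (d * a * c) := mul_left_cancel₀ hd (by linear_combination -hm0)
  have hz2 : z.1 2 = a * c + m * (a * b * c ^ 2) :=
    mul_left_cancel₀ hd (by linear_combination -hm2)
  have hz3 : z.1 3 = m := mul_left_cancel₀ hd (by linear_combination -hm3)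
  have hw2 : w.1 2 = u * (b * c) + w.1 1 * (d * a * c) - w.1 3 * (a * b * c ^ 2) :=
    mul_left_cancel₀ hd (by linear_combination hw + b * c * hu)
  obtain ⟨q, hq⟩ : ∃ q, q = d * w.1 1 - b * c * w.1 3 := ⟨_, rfl⟩
  obtain ⟨s, hs⟩ : ∃ s, s = z.1 1 * w.1 3 - m * w.1 1 := ⟨_, rfl⟩
  have hw1 : w.1 1 = q * z.1 1 + s * (b * c) := by
    rw [hq, hs]; linear_combination w.1 1 * hm1
  have hw3 : w.1 3 = q * m + s * d := by
    rw [hq, hs]; linear_combination w.1 3 * hm1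
  refine ⟨u - q * m * a * c - s * d * a * c, q, ?_⟩
  refine (qmk₁_eq_iff a b c d w ((u - q * m * a * c - s * d * a * c) • α₁elt a b c d +
    q • z)).2 ⟨s, fun i => ?_⟩
  simp only [Submodule.coe_add, Submodule.coe_smul, Pi.add_apply, Pi.smul_apply, smul_eq_mul, coe_α₁elt]
  fin_cases i <;> simp [vMuk₁]
  · rw [hu, hz0]; ring
  · rw [hw1]; ring
  · rw [hw2, hz2, hw3, hw1]; linear_combination (q * a * c) * hm1
  · rw [hw3, hz3]; ring

/-- The linear map `v⊥/ℤv → M` sending the classes of `α` and `β` to given elements. -/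
lemma exists_linearMap_apply_eq (a b c : ℤ) {M : Type*} [AddCommGroup M] (m n : M) :
    ∃ φ : Qspace a b c →ₗ[ℤ] M,
      φ (qmk a b c (αelt a b c)) = m ∧ φ (qmk a b c (βelt a b c)) = n := by
  let f : Vperp (vMuk a b c) →ₗ[ℤ] M :=
    ((LinearMap.proj 0 - (a * c) • LinearMap.proj 3 : (Fin 4 → ℤ) →ₗ[ℤ] ℤ).smulRight m +
      (LinearMap.proj 1 - (b * c) • LinearMap.proj 3 : (Fin 4 → ℤ) →ₗ[ℤ] ℤ).smulRight n) ∘ₗ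
      (Vperp (vMuk a b c)).subtype
  have hfw (w) : f w = (w.1 0 - a * c * w.1 3) • m + (w.1 1 - b * c * w.1 3) • n := rfl
  have hf : Zv a b c ≤ LinearMap.ker f := by
    rw [Zv, Submodule.span_singleton_le_iff_mem, LinearMap.mem_ker, hfw]
    simp [vMuk]
  refine ⟨(Zv a b c).liftQ f hf, ?_, ?_⟩
  · change f (αelt a b c) = m
    simp [hfw]
  · change f (βelt a b c) = n
    simp [hfw]

/-- With `gcd(a,b) = 1` and `gcd(d,bc) = 1`, `ᾱ, β̄` the basis of `v⊥/ℤv` and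
`ᾱ₁, β̃₁` the basis of `v₁⊥/ℤv₁` (where `d·β̃₁ = β₁ mod ℤv₁`), and
`t̃ = −a·ᾱ − b·β̄`, `t̃₁ = −a·ᾱ₁ − b·β̃₁`:  the ℤ-linear map
`φ : v⊥/ℤv → v₁⊥/ℤv₁` defined by `φ(ᾱ) = ᾱ₁` and `φ(β̄) = β̃₁` is an isometry of
the induced bilinear forms, and `φ(t̃) = t̃₁`. -/
theorem stmt12 (a b c d : ℤ) (ha : 0 < a) (hb : 0 < b) (hc : 0 < c) (hd : 0 < d)
    (hab : Int.gcd a b = 1) (hcop : Int.gcd d (b * c) = 1)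
    (Bbar : Qspace a b c →ₗ[ℤ] Qspace a b c →ₗ[ℤ] ℤ)
    (hBbar : ∀ x y : Vperp (vMuk a b c),
      Bbar (qmk a b c x) (qmk a b c y) = B4 (x : Fin 4 → ℤ) (y : Fin 4 → ℤ))
    (Bbar₁ : Qspace₁ a b c d →ₗ[ℤ] Qspace₁ a b c d →ₗ[ℤ] ℤ)
    (hBbar₁ : ∀ x y : Vperp (vMuk₁ a b c d),
      Bbar₁ (qmk₁ a b c d x) (qmk₁ a b c d y) = B4 (x : Fin 4 → ℤ) (y : Fin 4 → ℤ))
    (βt : Qspace₁ a b c d) (hβt : d • βt = qmk₁ a b c d (β₁elt a b c d)) :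
    ∃ φ : Qspace a b c →ₗ[ℤ] Qspace₁ a b c d,
      φ (qmk a b c (αelt a b c)) = qmk₁ a b c d (α₁elt a b c d) ∧
      φ (qmk a b c (βelt a b c)) = βt ∧
      (∀ x y : Qspace a b c, Bbar₁ (φ x) (φ y) = Bbar x y) ∧
      (∀ y : Qspace₁ a b c d, ∃ x : Qspace a b c, φ x = y) ∧
      (∀ x x' : Qspace a b c, φ x = φ x' → x = x') ∧
      φ (-a • qmk a b c (αelt a b c) - b • qmk a b c (βelt a b c))
        = -a • qmk₁ a b c d (α₁elt a b c d) - b • βt := by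
  have hd0 : d ≠ 0 := hd.ne'
  obtain ⟨φ, hα, hβ⟩ := exists_linearMap_apply_eq a b c (qmk₁ a b c d (α₁elt a b c d)) βt
  have hαα : Bbar (qmk a b c (αelt a b c)) (qmk a b c (αelt a b c)) = 0 := by
    rw [hBbar]; simp [B4]
  have hαβ : Bbar (qmk a b c (αelt a b c)) (qmk a b c (βelt a b c)) = -1 := by
    rw [hBbar]; simp [B4]
  have hβα : Bbar (qmk a b c (βelt a b c)) (qmk a b c (αelt a b c)) = -1 := by
    rw [hBbar]; simp [B4]
  have hββ : Bbar (qmk a b c (βelt a b c)) (qmk a b c (βelt a b c)) = 0 := by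
    rw [hBbar]; simp [B4]
  have hαα₁ : Bbar₁ (qmk₁ a b c d (α₁elt a b c d)) (qmk₁ a b c d (α₁elt a b c d)) = 0 := by
    rw [hBbar₁]; simp [B4]
  have hαβ₁ : Bbar₁ (qmk₁ a b c d (α₁elt a b c d)) βt = -1 := by
    apply mul_left_cancel₀ hd0
    rw [← smul_eq_mul, ← map_smul, hβt, hBbar₁]; simp [B4]
  have hβα₁ : Bbar₁ βt (qmk₁ a b c d (α₁elt a b c d)) = -1 := by
    apply mul_left_cancel₀ hd0
    rw [← smul_eq_mul, ← LinearMap.smul_apply, ← map_smul, hβt, hBbar₁]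
    simp [B4]
  have hββ₁ : Bbar₁ βt βt = 0 := by
    apply mul_left_cancel₀ hd0
    apply mul_left_cancel₀ hd0
    rw [← smul_eq_mul d (Bbar₁ βt βt), ← map_smul, hβt, ← smul_eq_mul, ← LinearMap.smul_apply,
      ← map_smul, hβt, hBbar₁]
    simp [B4]
  have hiso : ∀ x y : Qspace a b c, Bbar₁ (φ x) (φ y) = Bbar x y := by
    intro x y
    obtain ⟨p, q, rfl⟩ := exists_eq_smul_add_smul a b c x
    obtain ⟨r, s, rfl⟩ := exists_eq_smul_add_smul a b c y
    simp only [map_add, map_smul, LinearMap.add_apply, LinearMap.smul_apply, hα, hβ,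
      hαα, hαβ, hβα, hββ, hαα₁, hαβ₁, hβα₁, hββ₁]
  refine ⟨φ, hα, hβ, hiso, fun y => ?_, fun x x' h => ?_, ?_⟩
  · obtain ⟨p, q, rfl⟩ := exists_eq_smul_add_smul₁ a b c d hd0
      (Int.isCoprime_iff_gcd_eq_one.2 hcop) βt hβt y
    exact ⟨p • qmk a b c (αelt a b c) + q • qmk a b c (βelt a b c), by
      rw [map_add, map_smul, map_smul, hα, hβ]⟩
  · have hB (y : Qspace a b c) : Bbar x y = Bbar x' y := by rw [← hiso, ← hiso, h]
    obtain ⟨p, q, rfl⟩ := exists_eq_smul_add_smul a b c x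
    obtain ⟨r, s, rfl⟩ := exists_eq_smul_add_smul a b c x'
    have h1 := hB (qmk a b c (αelt a b c))
    have h2 := hB (qmk a b c (βelt a b c))
    simp only [map_add, map_smul, LinearMap.add_apply, LinearMap.smul_apply,
      hαα, hαβ, hβα, hββ, smul_eq_mul] at h1 h2
    rw [show p = r by linarith, show q = s by linarith]
  · rw [map_sub, map_smul, map_smul, hα, hβ]
end

section
/- Let a₁, b₁, c, γ be positive integers with gcd(a₁,b₁) = 1 and γ | 2a₁b₁; set γ_a = gcd(γ,a₁), γ_b = gcd(γ,b₁), and m = 2a₁b₁c²/γ. Let μ be an integer. Suppose p, q are integers with p ≡ μ·q (mod m), (b₁/γ_b)·c divides p, and b₁·c divides q. Then there exist a positive integer d₂ and integers D_x, D_y with D_x ≡ μ·D_y (mod m) such that p = d₂·m + b₁c·D_x and q = b₁c·D_y. -/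
/-- Let `a₁, b₁, c, γ` be positive integers with `gcd(a₁,b₁) = 1` and `γ ∣ 2a₁b₁`;
set `γ_b = gcd(γ,b₁)` and `m = 2a₁b₁c²/γ`.  Let `μ` be an integer.  Suppose `p, q`
are integers with `p ≡ μq (mod m)`, `(b₁/γ_b)·c ∣ p`, and `b₁c ∣ q`.  Then there
exist a positive integer `d₂` and integers `D_x, D_y` with `D_x ≡ μ·D_y (mod m)`
such that `p = d₂·m + b₁c·D_x` and `q = b₁c·D_y`. -/
theorem stmt15 (a₁ b₁ c γ : ℕ) (ha₁ : 0 < a₁) (hb₁ : 0 < b₁) (hc : 0 < c)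
    (hγpos : 0 < γ) (hab : Nat.gcd a₁ b₁ = 1) (hγ : γ ∣ 2 * a₁ * b₁)
    (m : ℕ) (hm : γ * m = 2 * a₁ * b₁ * c ^ 2)
    (μ p q : ℤ)
    (hpq : p ≡ μ * q [ZMOD (m : ℤ)])
    (hp : ((b₁ / Nat.gcd γ b₁ * c : ℕ) : ℤ) ∣ p)
    (hq : ((b₁ * c : ℕ) : ℤ) ∣ q) :
    ∃ d₂ : ℤ, 0 < d₂ ∧ ∃ Dx Dy : ℤ,
      Dx ≡ μ * Dy [ZMOD (m : ℤ)] ∧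
      p = d₂ * m + (b₁ * c : ℕ) * Dx ∧ q = (b₁ * c : ℕ) * Dy := by
  obtain ⟨Dy, rfl⟩ := hq
  obtain ⟨k, hk⟩ := hpq.symm.dvd
  have hbc : (1 : ℤ) ≤ ((b₁ * c : ℕ) : ℤ) := by exact_mod_cast Nat.mul_pos hb₁ hc
  refine ⟨k + (b₁ * c : ℕ) * (|k| + 1), ?_, μ * Dy - m * (|k| + 1), Dy, ?_, ?_, rfl⟩
  · nlinarith [neg_abs_le k, abs_nonneg k]
  · exact (Int.modEq_iff_dvd.mpr ⟨|k| + 1, by ring⟩)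
  · linear_combination hk
end
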